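/- arXiv:2605.04105 — 8 statements merged into one kernel-verified Lean document; each statement's English description precedes it below -/
import Mathlib

section
/- There exists an absolute constant c > 0 such that for every integer n ≥ 5 the 4-uniform hypergraph Ramsey number satisfies r_4(5,n) ≥ 2^(2^(c·n^(1/5))). Equivalently, for every n ≥ 5 there exist an integer M ≥ 2^(2^(c·n^(1/5))) and a set E of 4-element subsets of {0,1,...,M−2} such that no 5-element subset of {0,...,M−2} has all five of its 4-element subsets in E, and every n-element subset of {0,...,M−2} contains some member of E. -/
section

open Finset

/-- The edge condition on the differences `x, y, z` of consecutive vertices. -/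
def StepEdge (χ : ℕ → ℕ → Bool) (x y z : ℕ) : Prop :=
  (x < y ∧ y < z ∧ χ z y = χ y x ∧ χ z x = !χ z y) ∨
  (z < y ∧ y < x ∧ χ x y = χ y z ∧ χ x z = !χ x y) ∨
  (y < x ∧ x < z ∧ χ x y = !χ z y) ∨
  (y < z ∧ z < x ∧ χ x z = χ z y ∧ χ z y = χ x y)

theorem not_all_stepEdge (χ : ℕ → ℕ → Bool) {p q r s : ℕ}
    (h1 : p ≠ q) (h2 : q ≠ r) (h3 : r ≠ s)
    (ha : StepEdge χ q r s) (hb : StepEdge χ (max p q) r s) (hc : StepEdge χ p (max q r) s)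
    (hd : StepEdge χ p q (max r s)) (he : StepEdge χ p q r) : False := by
  rcases lt_or_gt_of_ne h1 with h1 | h1 <;> rcases lt_or_gt_of_ne h2 with h2 | h2 <;>
  rcases lt_or_gt_of_ne h3 with h3 | h3 <;>
  simp only [max_eq_left h1.le, max_eq_right h1.le, max_eq_left h2.le, max_eq_right h2.le,
    max_eq_left h3.le, max_eq_right h3.le] at hb hc hd <;>
  unfold StepEdge at * <;> grind

theorem no_path_LRLRLR (φ : Fin 7 → Fin 7 → Bool)
    (hLR : ∀ i j k : Fin 7, i < j → j < k → i.val % 2 = 0 → j.val % 2 = 1 → φ j k = φ i k)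
    (hRL : ∀ i j k : Fin 7, i < j → j < k → i.val % 2 = 1 → j.val % 2 = 0 →
      ¬ (φ i j = φ j k ∧ φ j k = φ i k)) : False := by
  have a1 := hLR 0 1 6 (by decide) (by decide) (by decide) (by decide)
  have a2 := hLR 0 3 6 (by decide) (by decide) (by decide) (by decide)
  have a3 := hLR 0 5 6 (by decide) (by decide) (by decide) (by decide)
  have a4 := hLR 2 5 6 (by decide) (by decide) (by decide) (by decide)
  have a5 := hLR 4 5 6 (by decide) (by decide) (by decide) (by decide)
  have a6 := hLR 2 3 4 (by decide) (by decide) (by decide) (by decide)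
  have b1 := hRL 1 2 6 (by decide) (by decide) (by decide) (by decide)
  have b2 := hRL 3 4 6 (by decide) (by decide) (by decide) (by decide)
  have b3 := hRL 1 4 6 (by decide) (by decide) (by decide) (by decide)
  have b4 := hRL 1 2 4 (by decide) (by decide) (by decide) (by decide)
  revert a1 a2 a3 a4 a5 a6 b1 b2 b3 b4
  generalize φ 0 6 = x06, φ 1 6 = x16, φ 3 6 = x36, φ 5 6 = x56, φ 2 6 = x26, φ 4 6 = x46,
    φ 3 4 = x34, φ 2 4 = x24, φ 1 2 = x12, φ 1 4 = x14
  revert x06 x16 x36 x56 x26 x46 x34 x24 x12 x14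
  decide

theorem no_path_RLRLRL (φ : Fin 7 → Fin 7 → Bool)
    (hRR : ∀ i j k : Fin 7, i < j → j < k → i.val % 2 = 0 → j.val % 2 = 0 → j.val < 6 →
      ¬ (φ i j = φ j k ∧ φ i k = !φ i j))
    (hLR : ∀ i j k : Fin 7, i < j → j < k → i.val % 2 = 1 → j.val % 2 = 0 → φ j k = φ i k)
    (hRL : ∀ i j k : Fin 7, i < j → j < k → i.val % 2 = 0 → j.val % 2 = 1 →
      ¬ (φ i j = φ j k ∧ φ j k = φ i k)) : False := by
  have a3 := hLR 1 2 3 (by decide) (by decide) (by decide) (by decide)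
  have a4 := hLR 1 2 4 (by decide) (by decide) (by decide) (by decide)
  have a5 := hLR 1 2 5 (by decide) (by decide) (by decide) (by decide)
  have a6 := hLR 1 2 6 (by decide) (by decide) (by decide) (by decide)
  have b5 := hLR 1 4 5 (by decide) (by decide) (by decide) (by decide)
  have b6 := hLR 1 4 6 (by decide) (by decide) (by decide) (by decide)
  have c5 := hLR 3 4 5 (by decide) (by decide) (by decide) (by decide)
  have c6 := hLR 3 4 6 (by decide) (by decide) (by decide) (by decide)
  have d4 := hRL 2 3 4 (by decide) (by decide) (by decide) (by decide)
  have d5 := hRL 2 3 5 (by decide) (by decide) (by decide) (by decide)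
  have d6 := hRL 2 3 6 (by decide) (by decide) (by decide) (by decide)
  have e6 := hRL 2 5 6 (by decide) (by decide) (by decide) (by decide)
  have f3 := hRL 0 1 3 (by decide) (by decide) (by decide) (by decide)
  have f4 := hRL 0 1 4 (by decide) (by decide) (by decide) (by decide)
  have f5 := hRL 0 1 5 (by decide) (by decide) (by decide) (by decide)
  have f6 := hRL 0 1 6 (by decide) (by decide) (by decide) (by decide)
  have g4 := hRL 0 3 4 (by decide) (by decide) (by decide) (by decide)
  have g5 := hRL 0 3 5 (by decide) (by decide) (by decide) (by decide)
  have g6 := hRL 0 3 6 (by decide) (by decide) (by decide) (by decide)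
  have i6 := hRL 0 5 6 (by decide) (by decide) (by decide) (by decide)
  have j3 := hRR 0 2 3 (by decide) (by decide) (by decide) (by decide) (by decide)
  have j4 := hRR 0 2 4 (by decide) (by decide) (by decide) (by decide) (by decide)
  have j5 := hRR 0 2 5 (by decide) (by decide) (by decide) (by decide) (by decide)
  have j6 := hRR 0 2 6 (by decide) (by decide) (by decide) (by decide) (by decide)
  have k5 := hRR 0 4 5 (by decide) (by decide) (by decide) (by decide) (by decide)
  have k6 := hRR 0 4 6 (by decide) (by decide) (by decide) (by decide) (by decide)
  clear hRR hLR hRL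
  cases h1 : φ 1 6 <;> cases h2 : φ 2 5 <;> cases h3 : φ 0 2 <;> cases h4 : φ 0 1 <;>
    cases h5 : φ 0 3 <;> simp_all

theorem card_filter_forall_eq {α : Type*} [Fintype α] [DecidableEq α] (A : Finset α)
    (g : α → Bool) :
    #{χ : α → Bool | ∀ a ∈ A, χ a = g a} = 2 ^ (Fintype.card α - #A) := by
  have h : ({χ : α → Bool | ∀ a ∈ A, χ a = g a} : Finset _) =
      Fintype.piFinset fun a => if a ∈ A then {g a} else univ := by
    ext χ
    simp only [mem_filter, mem_univ, true_and, Fintype.mem_piFinset]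
    refine forall_congr' fun a => ?_
    split_ifs with ha <;> simp [ha]
  rw [h, Fintype.card_piFinset, ← card_compl, ← prod_const]
  rw [← prod_subset (subset_univ Aᶜ)]
  · refine prod_congr rfl fun a ha => ?_
    simp [mem_compl.1 ha]
  · intro a _ ha
    simp [not_not.1 (mt mem_compl.2 ha)]

/-- The unordered pair of `x` and `y`, larger element first. -/
def sortedPair {α : Type*} [LinearOrder α] (x y : α) : α × α := (max x y, min x y)

theorem sortedPair_eq_imp {α : Type*} [LinearOrder α] {x y x' y' : α}
    (h : sortedPair x y = sortedPair x' y') : (x = x' ∧ y = y') ∨ (x = y' ∧ y = x') := by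
  simp only [sortedPair, Prod.mk.injEq] at h
  grind

theorem exists_tournament {N t : ℕ} (hN : N ^ t < 2 ^ (t.choose 2)) :
    ∃ χ : Fin N × Fin N → Bool, ∀ f : Fin t → Fin N, Function.Injective f →
      ∃ i j, i < j ∧ χ (sortedPair (f i) (f j)) ≠ decide (f j < f i) := by
  classical
  by_contra! hcon
  let pairs : Finset (Fin t × Fin t) := {p | p.1 < p.2}
  have hpairs : #pairs = t.choose 2 := by
    rw [card_eq_sum_card_fiberwise (f := Prod.snd) (t := univ) (by simp), Nat.choose_two_right,
      ← sum_range_id, ← Fin.sum_univ_eq_sum_range]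
    refine sum_congr rfl fun j _ => ?_
    rw [← Fin.card_Iio j]
    refine card_nbij Prod.fst ?_ ?_ ?_
    · rintro ⟨i, j'⟩ h
      simp only [pairs, coe_filter, mem_filter, mem_univ, true_and, Set.mem_ofPred_eq, coe_Iio,
        Set.mem_Iio] at h ⊢
      exact h.2 ▸ h.1
    · rintro ⟨i, j'⟩ h ⟨i', j''⟩ h' hi
      simp only [coe_filter, Set.mem_ofPred_eq] at h h' hi
      rw [hi, h.2, h'.2]
    · intro i hi
      exact ⟨(i, j), by simpa [pairs] using hi, rfl⟩
  let bad (f : Fin t → Fin N) : Finset (Fin N × Fin N → Bool) :=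
    {χ | ∀ i j, i < j → χ (sortedPair (f i) (f j)) = decide (f j < f i)}
  have hbad : ∀ f : Fin t → Fin N, Function.Injective f →
      #(bad f) * 2 ^ (t.choose 2) ≤ 2 ^ (N * N) := by
    intro f hf
    have hinj : Set.InjOn (fun p : Fin t × Fin t => sortedPair (f p.1) (f p.2)) pairs := by
      rintro ⟨i, j⟩ hij ⟨i', j'⟩ hij' h
      simp only [pairs, coe_filter, mem_univ, true_and, Set.mem_ofPred_eq] at hij hij'
      rcases sortedPair_eq_imp h with ⟨h1, h2⟩ | ⟨h1, h2⟩
      · exact Prod.ext (hf h1) (hf h2)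
      · have h1 := hf h1
        have h2 := hf h2
        subst h1 h2
        exact absurd hij (not_lt.2 hij'.le)
    let A := pairs.image fun p => sortedPair (f p.1) (f p.2)
    have hA : #A = t.choose 2 := by rw [card_image_of_injOn hinj, hpairs]
    by_cases hne : (bad f).Nonempty
    · obtain ⟨g, hg⟩ := hne
      have hsub : bad f ⊆ ({χ | ∀ a ∈ A, χ a = g a} : Finset (Fin N × Fin N → Bool)) := by
        intro χ hχ
        simp only [bad, mem_filter, mem_univ, true_and] at hχ hg ⊢
        intro a ha
        obtain ⟨p, hp, rfl⟩ := mem_image.1 ha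
        have hp : p.1 < p.2 := by simpa [pairs] using hp
        rw [hχ _ _ hp, hg _ _ hp]
      have hle : t.choose 2 ≤ N * N := by
        simpa [hA] using card_le_univ A
      calc #(bad f) * 2 ^ (t.choose 2) ≤ 2 ^ (N * N - t.choose 2) * 2 ^ (t.choose 2) := by
            gcongr
            exact (card_le_card hsub).trans_eq (by rw [card_filter_forall_eq, hA]; simp)
        _ = 2 ^ (N * N) := by rw [← pow_add, Nat.sub_add_cancel hle]
    · rw [not_nonempty_iff_eq_empty.1 hne]; simp
  have hcover : (univ : Finset (Fin N × Fin N → Bool)) ⊆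
      ({f | Function.Injective f} : Finset (Fin t → Fin N)).biUnion bad := by
    intro χ _
    obtain ⟨f, hf, h⟩ := hcon χ
    simp only [mem_biUnion, mem_filter, mem_univ, true_and, bad]
    exact ⟨f, hf, h⟩
  have hcard : 2 ^ (N * N) * 2 ^ (t.choose 2) ≤ N ^ t * 2 ^ (N * N) := by
    calc 2 ^ (N * N) * 2 ^ (t.choose 2)
        = #(univ : Finset (Fin N × Fin N → Bool)) * 2 ^ (t.choose 2) := by simp
      _ ≤ (∑ f : Fin t → Fin N with Function.Injective f, #(bad f)) * 2 ^ (t.choose 2) := by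
          gcongr
          exact (card_le_card hcover).trans card_biUnion_le
      _ ≤ ∑ f : Fin t → Fin N with Function.Injective f, 2 ^ (N * N) := by
          rw [sum_mul]
          exact sum_le_sum fun f hf => hbad f (mem_filter.1 hf).2
      _ ≤ N ^ t * 2 ^ (N * N) := by
          rw [sum_const, smul_eq_mul]
          gcongr
          exact (card_filter_le _ _).trans (by simp)
  rw [mul_comm] at hcard
  exact absurd (Nat.le_of_mul_le_mul_right hcard (by positivity)) (not_le.2 hN)

theorem exists_ordering_of_no_cyclic_triple (χ : ℕ → ℕ → Bool) (A : Finset ℕ) {t : ℕ}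
    (hA : t ≤ #A)
    (hχ : ∀ h ∈ A, ∀ r ∈ A, ∀ u ∈ A, u < r → r < h → ¬ (χ h r = χ r u ∧ χ h u = !χ h r)) :
    ∃ f : Fin t → ℕ, Function.Injective f ∧ (∀ i, f i ∈ A) ∧
      ∀ i j, i < j → χ (max (f i) (f j)) (min (f i) (f j)) = decide (f j < f i) := by
  classical
  let arrow (x y : A) : Prop :=
    x = y ∨ (y.1 < x.1 ∧ χ x y = true) ∨ (x.1 < y.1 ∧ χ y x = false)
  have hanti : Std.Antisymm arrow := ⟨fun x y hxy hyx => by grind⟩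
  have htotal : Std.Total arrow := ⟨fun x y => by
    rcases lt_trichotomy x.1 y.1 with h | h | h
    · cases hc : χ y x <;> grind
    · exact Or.inl (Or.inl (Subtype.ext h))
    · cases hc : χ x y <;> grind⟩
  have htrans : IsTrans A arrow := ⟨fun ⟨x, hx⟩ ⟨y, hy⟩ ⟨z, hz⟩ hxy hyz => by
    have h1 := hχ x hx y hy z hz
    have h2 := hχ x hx z hz y hy
    have h3 := hχ y hy x hx z hz
    have h4 := hχ y hy z hz x hx
    have h5 := hχ z hz x hx y hy
    have h6 := hχ z hz y hy x hx
    simp only [arrow, Subtype.mk.injEq] at hxy hyz ⊢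
    grind⟩
  let l := (univ : Finset A).sort arrow
  have hl : l.length = #A := by simp [l]
  have hpair : l.Pairwise arrow := pairwise_sort _ _
  have hnodup : l.Nodup := sort_nodup _ _
  refine ⟨fun i => (l.get (i.castLE (hA.trans_eq hl.symm))).1, ?_, fun i => Subtype.prop _, ?_⟩
  · intro i j hij
    have := List.nodup_iff_injective_get.1 hnodup (Subtype.ext hij)
    exact Fin.castLE_injective _ this
  · intro i j hij
    have h := List.pairwise_iff_get.1 hpair (i.castLE (hA.trans_eq hl.symm))
      (j.castLE (hA.trans_eq hl.symm)) hij
    have hne : l.get (i.castLE (hA.trans_eq hl.symm)) ≠ l.get (j.castLE (hA.trans_eq hl.symm)) :=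
      fun h => hij.ne (Fin.castLE_injective _ (List.nodup_iff_injective_get.1 hnodup h))
    rcases h.resolve_left hne with ⟨h, hc⟩ | ⟨h, hc⟩
    · rw [max_eq_left h.le, min_eq_right h.le, hc, decide_eq_true h]
    · rw [max_eq_right h.le, min_eq_left h.le, hc, decide_eq_false h.not_gt]

theorem exists_coloring_cyclic_triple (s : ℕ) :
    ∃ χ : ℕ → ℕ → Bool, ∀ A ⊆ range (2 ^ s), 2 * s + 2 ≤ #A →
      ∃ h ∈ A, ∃ r ∈ A, ∃ u ∈ A, u < r ∧ r < h ∧ χ h r = χ r u ∧ χ h u = !χ h r := by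
  have hpow : (2 ^ s) ^ (2 * s + 2) < 2 ^ ((2 * s + 2).choose 2) := by
    rw [← pow_mul]
    refine Nat.pow_lt_pow_right one_lt_two ?_
    rw [Nat.choose_two_right, show (2 * s + 2) * (2 * s + 2 - 1) = 2 * ((s + 1) * (2 * s + 1)) by
      rw [show 2 * s + 2 - 1 = 2 * s + 1 by omega]; ring, Nat.mul_div_cancel_left _ two_pos]
    nlinarith
  obtain ⟨χ, hχ⟩ := exists_tournament hpow
  refine ⟨fun x y => if h : x < 2 ^ s ∧ y < 2 ^ s then χ (⟨x, h.1⟩, ⟨y, h.2⟩) else false,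
    fun A hA ht => ?_⟩
  by_contra! hcon
  obtain ⟨f, hinj, hfA, hf⟩ := exists_ordering_of_no_cyclic_triple _ A ht
    fun h hh r hr u hu h1 h2 h3 => hcon h hh r hr u hu h1 h2 h3.1 h3.2
  have hlt : ∀ i, f i < 2 ^ s := fun i => mem_range.1 (hA (hfA i))
  obtain ⟨i, j, hij, hne⟩ := hχ (fun i => ⟨f i, hlt i⟩) fun i j h => hinj (Fin.mk.inj h)
  refine hne ?_
  have h := hf i j hij
  simp only [max_lt (hlt i) (hlt j), min_lt_of_left_lt (hlt i), and_self, dite_true] at h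
  have hp : sortedPair (⟨f i, hlt i⟩ : Fin (2 ^ s)) ⟨f j, hlt j⟩ =
      (⟨max (f i) (f j), max_lt (hlt i) (hlt j)⟩,
        ⟨min (f i) (f j), min_lt_of_left_lt (hlt i)⟩) := by
    rcases le_total (f i) (f j) with hle | hle <;> simp [sortedPair, hle]
  rw [hp, h]
  simp only [Fin.mk_lt_mk]

/-- `IsTopBit a b m`: the highest bit where `a` and `b` differ is `m`, and `a < b`. -/
def IsTopBit (a b m : ℕ) : Prop :=
  a.testBit m = false ∧ b.testBit m = true ∧ ∀ k, m < k → a.testBit k = b.testBit k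

theorem IsTopBit.lt {a b m : ℕ} (h : IsTopBit a b m) : a < b :=
  Nat.lt_of_testBit m h.1 h.2.1 h.2.2

theorem IsTopBit.unique {a b m m' : ℕ} (h : IsTopBit a b m) (h' : IsTopBit a b m') : m = m' := by
  obtain ⟨h1, h2, h3⟩ := h
  obtain ⟨h1', h2', h3'⟩ := h'
  rcases lt_trichotomy m m' with hlt | rfl | hlt
  · have := h3 _ hlt; simp_all
  · rfl
  · have := h3' _ hlt; simp_all

theorem exists_isTopBit_of_ne {a b : ℕ} (h : a ≠ b) :
    ∃ m, a.testBit m ≠ b.testBit m ∧ ∀ k, m < k → a.testBit k = b.testBit k := by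
  obtain ⟨m, hm, hk⟩ := Nat.exists_most_significant_bit (mt Nat.xor_eq_zero_iff.1 h)
  refine ⟨m, by simpa using hm, fun k hk' => by simpa using hk k hk'⟩

theorem exists_isTopBit {a b : ℕ} (h : a < b) : ∃ m, IsTopBit a b m := by
  obtain ⟨m, hm, hk⟩ := exists_isTopBit_of_ne h.ne
  refine ⟨m, ?_⟩
  cases ha : a.testBit m <;> cases hb : b.testBit m
  · simp_all
  · exact ⟨ha, hb, hk⟩
  · exact absurd h (Nat.lt_of_testBit m hb ha fun k h => (hk k h).symm).not_gt
  · simp_all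

theorem IsTopBit.trans {a b c m m' : ℕ} (h : IsTopBit a b m) (h' : IsTopBit b c m') :
    m ≠ m' ∧ IsTopBit a c (max m m') := by
  obtain ⟨h1, h2, h3⟩ := h
  obtain ⟨h1', h2', h3'⟩ := h'
  have hne : m ≠ m' := by rintro rfl; simp_all
  refine ⟨hne, ?_⟩
  rcases lt_or_gt_of_ne hne with hlt | hlt
  · rw [max_eq_right hlt.le]
    exact ⟨(h3 _ hlt).trans h1', h2', fun k hk => (h3 _ (hlt.trans hk)).trans (h3' _ hk)⟩
  · rw [max_eq_left hlt.le]
    exact ⟨h1, (h3' _ hlt).symm.trans h2, fun k hk => (h3 _ hk).trans (h3' _ (hlt.trans hk))⟩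

theorem sorted_quadruple_unique {a b c d a' b' c' d' : ℕ} (h1 : a < b) (h2 : b < c) (h3 : c < d)
    (h1' : a' < b') (h2' : b' < c') (h3' : c' < d')
    (h : ({a, b, c, d} : Finset ℕ) = {a', b', c', d'}) : a = a' ∧ b = b' ∧ c = c' ∧ d = d' := by
  have e1 := (Finset.ext_iff.1 h a)
  have e2 := (Finset.ext_iff.1 h b)
  have e3 := (Finset.ext_iff.1 h c)
  have e4 := (Finset.ext_iff.1 h d)
  have f1 := (Finset.ext_iff.1 h a')
  have f2 := (Finset.ext_iff.1 h b')
  have f3 := (Finset.ext_iff.1 h c')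
  have f4 := (Finset.ext_iff.1 h d')
  simp only [mem_insert, mem_singleton, true_or, or_true, true_iff, iff_true] at e1 e2 e3 e4 f1 f2 f3 f4
  omega

/-- Lists made of at most `k` runs of length at most `t`, the first of which consists of `b`'s
and may be empty. -/
def runLists (t : ℕ) : ℕ → Bool → Finset (List Bool)
  | 0, _ => {[]}
  | k + 1, b => (range (t + 1) ×ˢ runLists t k !b).image fun p => List.replicate p.1 b ++ p.2

theorem card_runLists_le (t k : ℕ) (b : Bool) : #(runLists t k b) ≤ (t + 1) ^ k := by
  induction k generalizing b with
  | zero => simp [runLists]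
  | succ k ih =>
    calc #(runLists t (k + 1) b) ≤ #(range (t + 1) ×ˢ runLists t k !b) := card_image_le
      _ ≤ (t + 1) ^ (k + 1) := by
        rw [card_product, card_range, pow_succ']
        gcongr
        exact ih _

/-- The alternating list of length `k` starting with `b`. -/
def alternating : ℕ → Bool → List Bool
  | 0, _ => []
  | k + 1, b => b :: alternating k !b

theorem nil_mem_runLists (t k : ℕ) (b : Bool) : [] ∈ runLists t k b := by
  induction k generalizing b with
  | zero => simp [runLists]
  | succ k ih => exact mem_image.2 ⟨(0, []), by simp [ih], rfl⟩

theorem mem_runLists {t k : ℕ} {b : Bool} {w : List Bool} (hw : ∀ c, w.count c ≤ t)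
    (h : ¬ (alternating k !b).Sublist w) : w ∈ runLists t k b := by
  induction k generalizing b w with
  | zero => exact absurd (List.nil_sublist w) h
  | succ k ih =>
    obtain ⟨i, v, rfl, hv⟩ : ∃ i v, w = List.replicate i b ++ v ∧ v.head? ≠ some b := by
      clear hw h
      induction w with
      | nil => exact ⟨0, [], by simp⟩
      | cons c w ihw =>
        by_cases hc : c = b
        · obtain ⟨i, v, rfl, hv⟩ := ihw
          exact ⟨i + 1, v, by simp [hc, List.replicate_succ], hv⟩
        · exact ⟨0, c :: w, by simp, by simpa using hc⟩
    have hi : i ≤ t := by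
      have := hw b
      simp only [List.count_append, List.count_replicate_self] at this
      omega
    refine mem_image.2 ⟨(i, v), mem_product.2 ⟨mem_range.2 (by omega), ?_⟩, rfl⟩
    cases v with
    | nil => exact nil_mem_runLists _ _ _
    | cons c v =>
      have hc : c = !b := by cases c <;> cases b <;> simp_all
      subst hc
      refine ih (fun c => (Nat.le_trans (by simp) (hw c))) fun hsub => h ?_
      refine (List.Sublist.trans ?_ (List.sublist_append_right _ _))
      rw [alternating]
      refine List.Sublist.cons_cons _ ?_
      cases k with
      | zero => exact List.nil_sublist _
      | succ k => simpa [alternating, List.cons_sublist_cons'] using hsub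

theorem card_le_of_forbidden_alternating {t : ℕ} (L : Finset (List Bool))
    (hcount : ∀ w ∈ L, ∀ c, w.count c ≤ t)
    (halt : ∀ w ∈ L, ∀ b c, ¬ (alternating 6 b ++ [c]).Sublist w) :
    #L ≤ 7 * (t + 1) ^ 5 := by
  let X : Finset (List Bool) :=
    insert [] (univ.biUnion fun b => (runLists t 5 b).image (List.cons b))
  let Y : Finset (List Bool) := insert [] (univ.biUnion fun c => X.image (· ++ [c]))
  have hX : #X ≤ 2 * (t + 1) ^ 5 + 1 := by
    refine (card_insert_le _ _).trans (Nat.succ_le_succ (card_biUnion_le.trans ?_))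
    refine (sum_le_card_nsmul _ _ ((t + 1) ^ 5) fun b _ =>
      card_image_le.trans (card_runLists_le _ _ _)).trans (by simp)
  have hY : #Y ≤ 2 * #X + 1 := by
    refine (card_insert_le _ _).trans (Nat.succ_le_succ (card_biUnion_le.trans ?_))
    exact (sum_le_card_nsmul _ _ #X fun b _ => card_image_le).trans (by simp)
  have hL : L ⊆ Y := by
    intro w hw
    rcases List.eq_nil_or_concat w with rfl | ⟨v, c, rfl⟩
    · exact mem_insert_self _ _
    rw [List.concat_eq_append] at hw ⊢
    refine mem_insert_of_mem (mem_biUnion.2 ⟨c, mem_univ _, mem_image.2 ⟨v, ?_, rfl⟩⟩)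
    have hv : ∀ d, v.count d ≤ t := fun d => Nat.le_trans (by simp) (hcount _ hw d)
    have hv' : ∀ b, ¬ (alternating 6 b).Sublist v := fun b h =>
      halt _ hw b c (h.append (List.Sublist.refl _))
    cases v with
    | nil => exact mem_insert_self _ _
    | cons b v =>
      refine mem_insert_of_mem (mem_biUnion.2 ⟨b, mem_univ _, mem_image.2 ⟨v, ?_, rfl⟩⟩)
      exact mem_runLists (fun d => Nat.le_trans (List.count_le_count_cons) (hv d)) fun h =>
        hv' b (h.cons_cons b)
  have hpos : 1 ≤ (t + 1) ^ 5 := Nat.one_le_pow _ _ (Nat.succ_pos _)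
  have := card_le_card hL
  omega

/-- The bits at which the binary tree spanned by `S` branches along the path to `x`. -/
def IsBranchBit (S : Finset ℕ) (x m : ℕ) : Prop :=
  ∃ y ∈ S, x.testBit m ≠ y.testBit m ∧ ∀ k, m < k → x.testBit k = y.testBit k

open Classical in
/-- The branching bits of `x` below `N`, in decreasing order. -/
noncomputable def branchList (S : Finset ℕ) (N x : ℕ) : List ℕ :=
  (List.range N).reverse.filter fun m => IsBranchBit S x m

theorem mem_branchList {S : Finset ℕ} {N x m : ℕ} :
    m ∈ branchList S N x ↔ m < N ∧ IsBranchBit S x m := by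
  simp [branchList]

theorem pairwise_branchList (S : Finset ℕ) (N x : ℕ) : (branchList S N x).Pairwise (· > ·) :=
  (List.pairwise_reverse.2 List.pairwise_lt_range).filter _

theorem eq_of_map_branchList_eq {S : Finset ℕ} {N x y : ℕ} (hx : x ∈ S) (hy : y ∈ S)
    (hagree : ∀ k, N ≤ k → x.testBit k = y.testBit k)
    (h : (branchList S N x).map x.testBit = (branchList S N y).map y.testBit) : x = y := by
  induction N with
  | zero => exact Nat.eq_of_testBit_eq fun k => hagree k (Nat.zero_le k)
  | succ n ih =>
    by_cases hxy : x.testBit n = y.testBit n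
    · have hagree' : ∀ k, n ≤ k → x.testBit k = y.testBit k := fun k hk =>
        (Nat.eq_or_lt_of_le hk).elim (fun e => e ▸ hxy) fun hk => hagree k hk
      have hiff : IsBranchBit S x n ↔ IsBranchBit S y n := by
        refine exists_congr fun z => and_congr_right fun _ => ?_
        rw [hxy]
        refine and_congr_right fun _ => forall₂_congr fun k hk => ?_
        rw [hagree k hk]
      refine ih hagree' ?_
      by_cases hb : IsBranchBit S x n
      · simpa [branchList, List.range_succ, hb, hiff.1 hb, hxy] using h
      · simpa [branchList, List.range_succ, hb, mt hiff.2 hb, hxy] using h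
    · have hbx : IsBranchBit S x n := ⟨y, hy, hxy, hagree⟩
      have hby : IsBranchBit S y n := ⟨x, hx, Ne.symm hxy, fun k hk => (hagree k hk).symm⟩
      simp [branchList, List.range_succ, hbx, hby, hxy] at h

/-- No four vertices of `S` span an edge of the stepping-up hypergraph of `χ`. -/
def IsStepIndependent (χ : ℕ → ℕ → Bool) (S : Finset ℕ) : Prop :=
  ∀ a ∈ S, ∀ b ∈ S, ∀ c ∈ S, ∀ d ∈ S, ∀ p q r, IsTopBit a b p → IsTopBit b c q →
    IsTopBit c d r → ¬ StepEdge χ p q r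

theorem IsStepIndependent.branch {χ : ℕ → ℕ → Bool} {S : Finset ℕ} (hS : IsStepIndependent χ S)
    {x m₁ m₂ m₃ : ℕ} (hx : x ∈ S) (h₁ : IsBranchBit S x m₁) (h₂ : IsBranchBit S x m₂)
    (h₃ : IsBranchBit S x m₃) (h21 : m₂ < m₁) (h32 : m₃ < m₂) :
    (x.testBit m₁ = x.testBit m₂ → ¬ (χ m₁ m₂ = χ m₂ m₃ ∧ χ m₁ m₃ = !χ m₁ m₂)) ∧
    (x.testBit m₁ = false → x.testBit m₂ = true → χ m₂ m₃ = χ m₁ m₃) ∧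
    (x.testBit m₁ = true → x.testBit m₂ = false → ¬ (χ m₁ m₂ = χ m₂ m₃ ∧ χ m₂ m₃ = χ m₁ m₃)) := by
  obtain ⟨y₁, hy₁, hd₁, ha₁⟩ := h₁
  obtain ⟨y₂, hy₂, hd₂, ha₂⟩ := h₂
  obtain ⟨u, hu, v, hv, huv, hau, hav⟩ : ∃ u ∈ S, ∃ v ∈ S, IsTopBit u v m₃ ∧
      (∀ k, m₃ < k → u.testBit k = x.testBit k) ∧ ∀ k, m₃ < k → v.testBit k = x.testBit k := by
    obtain ⟨y₃, hy₃, hd₃, ha₃⟩ := h₃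
    cases hb : x.testBit m₃
    · exact ⟨x, hx, y₃, hy₃, ⟨hb, by simp_all, ha₃⟩, fun _ _ => rfl, fun k hk => (ha₃ k hk).symm⟩
    · exact ⟨y₃, hy₃, x, hx, ⟨by simp_all, hb, fun k hk => (ha₃ k hk).symm⟩,
        fun k hk => (ha₃ k hk).symm, fun _ _ => rfl⟩
  have ha₂' : ∀ k, m₂ < k → y₂.testBit k = x.testBit k := fun k hk => (ha₂ k hk).symm
  have below : ∀ z y m j, j < m → (∀ k, j < k → z.testBit k = x.testBit k) →
      x.testBit m = false → x.testBit m ≠ y.testBit m →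
      (∀ k, m < k → x.testBit k = y.testBit k) → IsTopBit z y m :=
    fun z y m j hj hz hf hne hk =>
      ⟨(hz m hj).trans hf, Bool.eq_true_of_not_eq_false fun h => hne (hf.trans h.symm),
        fun k h => (hz k (hj.trans h)).trans (hk k h)⟩
  have above : ∀ z y m j, j < m → (∀ k, j < k → z.testBit k = x.testBit k) →
      x.testBit m = true → x.testBit m ≠ y.testBit m →
      (∀ k, m < k → x.testBit k = y.testBit k) → IsTopBit y z m :=
    fun z y m j hj hz hf hne hk =>
      ⟨Bool.eq_false_of_not_eq_true fun h => hne (hf.trans h.symm), (hz m hj).trans hf,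
        fun k h => ((hz k (hj.trans h)).trans (hk k h)).symm⟩
  refine ⟨fun h12 hχ => ?_, fun hb₁ hb₂ => ?_, fun hb₁ hb₂ hχ => ?_⟩
  · cases hb₂ : x.testBit m₂
    · have hb₁ := h12.trans hb₂
      exact hS u hu v hv y₂ hy₂ y₁ hy₁ m₃ m₂ m₁ huv (below v y₂ m₂ m₃ h32 hav hb₂ hd₂ ha₂)
        (below y₂ y₁ m₁ m₂ h21 ha₂' hb₁ hd₁ ha₁) (Or.inl ⟨h32, h21, hχ⟩)
    · have hb₁ := h12.trans hb₂
      exact hS y₁ hy₁ y₂ hy₂ u hu v hv m₁ m₂ m₃ (above y₂ y₁ m₁ m₂ h21 ha₂' hb₁ hd₁ ha₁)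
        (above u y₂ m₂ m₃ h32 hau hb₂ hd₂ ha₂) huv (Or.inr (Or.inl ⟨h32, h21, hχ⟩))
  · by_contra hχ
    exact hS y₂ hy₂ u hu v hv y₁ hy₁ m₂ m₃ m₁ (above u y₂ m₂ m₃ h32 hau hb₂ hd₂ ha₂) huv
      (below v y₁ m₁ m₃ (h32.trans h21) hav hb₁ hd₁ ha₁)
      (Or.inr (Or.inr (Or.inl ⟨h32, h21, Bool.eq_not_of_ne hχ⟩)))
  · exact hS y₁ hy₁ u hu v hv y₂ hy₂ m₁ m₃ m₂
      (above u y₁ m₁ m₃ (h32.trans h21) hau hb₁ hd₁ ha₁) huv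
      (below v y₂ m₂ m₃ h32 hav hb₂ hd₂ ha₂) (Or.inr (Or.inr (Or.inr ⟨h32, h21, hχ⟩)))

theorem IsStepIndependent.card_le {χ : ℕ → ℕ → Bool} {S : Finset ℕ} {s : ℕ}
    (hχ : ∀ A ⊆ range (2 ^ s), 2 * s + 2 ≤ #A →
      ∃ h ∈ A, ∃ r ∈ A, ∃ u ∈ A, u < r ∧ r < h ∧ χ h r = χ r u ∧ χ h u = !χ h r)
    (hS : IsStepIndependent χ S) (hSN : S ⊆ range (2 ^ 2 ^ s)) :
    #S ≤ 7 * (2 * s + 2) ^ 5 := by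
  let word : ℕ → List Bool := fun x => (branchList S (2 ^ s) x).map x.testBit
  have hinj : Set.InjOn word S := fun x hx y hy h => by
    refine eq_of_map_branchList_eq hx hy (fun k hk => ?_) h
    have hbit : ∀ z ∈ S, z.testBit k = false := fun z hz => Nat.testBit_lt_two_pow
      ((mem_range.1 (hSN hz)).trans_le (Nat.pow_le_pow_right two_pos hk))
    rw [hbit x hx, hbit y hy]
  rw [← card_image_of_injOn hinj]
  refine card_le_of_forbidden_alternating (t := 2 * s + 1) _ (fun w hw c => ?_)
    (fun w hw b c hsub => ?_)
  · obtain ⟨x, hx, rfl⟩ := mem_image.1 hw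
    by_contra! hlt
    have hnodup : ((branchList S (2 ^ s) x).filter fun m => x.testBit m == c).Nodup :=
      ((pairwise_branchList S (2 ^ s) x).imp fun h => ne_of_gt h).filter _
    obtain ⟨h, hh, r, hr, u, hu, hur, hrh, hcyc⟩ := hχ
      ((branchList S (2 ^ s) x).filter fun m => x.testBit m == c).toFinset
      (fun m hm => by
        simp only [List.mem_toFinset, List.mem_filter, mem_branchList] at hm
        exact mem_range.2 hm.1.1)
      (by
        rw [List.toFinset_card_of_nodup hnodup, ← List.countP_eq_length_filter]
        rw [List.count, List.countP_map] at hlt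
        exact hlt)
    simp only [List.mem_toFinset, List.mem_filter, mem_branchList, beq_iff_eq] at hh hr hu
    exact (hS.branch hx hh.1.2 hr.1.2 hu.1.2 hrh hur).1 (hh.2.trans hr.2.symm) hcyc
  · obtain ⟨x, hx, rfl⟩ := mem_image.1 hw
    obtain ⟨l, hl, hmap⟩ := List.sublist_map_iff.1 hsub
    have hlen : l.length = 7 := by simpa [alternating] using (congrArg List.length hmap).symm
    have hdec := (pairwise_branchList S (2 ^ s) x).sublist hl
    obtain ⟨m, rfl⟩ : ∃ m : Fin 7 → ℕ, l = List.ofFn m :=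
      ⟨fun i => l.get (i.cast hlen.symm), l.ofFn_get.symm.trans (List.ofFn_congr hlen _)⟩
    have hm : ∀ i j : Fin 7, i < j → m j < m i := fun i j hij =>
      List.pairwise_ofFn.1 hdec hij
    have hbr : ∀ i, IsBranchBit S x (m i) := fun i =>
      (mem_branchList.1 (hl.subset (List.mem_ofFn.2 ⟨i, rfl⟩))).2
    have hbit : ∀ i : Fin 7, i.val < 6 → x.testBit (m i) = if i.val % 2 = 0 then b else !b := by
      simp only [alternating, List.map_cons, List.ofFn_succ, List.ofFn_zero, List.cons_append,
        List.nil_append, List.cons.injEq, Bool.not_not] at hmap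
      obtain ⟨e0, e1, e2, e3, e4, e5, -⟩ := hmap
      intro i hi
      fin_cases i
      · exact e0.symm
      · exact e1.symm
      · exact e2.symm
      · exact e3.symm
      · exact e4.symm
      · exact e5.symm
      · exact absurd hi (by decide)
    have key := fun i j k (hij : i < j) (hjk : j < k) =>
      hS.branch hx (hbr i) (hbr j) (hbr k) (hm i j hij) (hm j k hjk)
    cases b
    · refine no_path_LRLRLR (fun i j => χ (m i) (m j)) (fun i j k hij hjk hi hj => ?_)
        fun i j k hij hjk hi hj => ?_
      · exact (key i j k hij hjk).2.1 (by simp [hbit i (by omega), hi])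
          (by simp [hbit j (by omega), hj])
      · exact (key i j k hij hjk).2.2 (by simp [hbit i (by omega), hi])
          (by simp [hbit j (by omega), hj])
    · refine no_path_RLRLRL (fun i j => χ (m i) (m j)) (fun i j k hij hjk hi hj hj6 => ?_)
        (fun i j k hij hjk hi hj => ?_) fun i j k hij hjk hi hj => ?_
      · exact (key i j k hij hjk).1 (by simp [hbit i (by omega), hbit j hj6, hi, hj])
      · exact (key i j k hij hjk).2.1 (by simp [hbit i (by omega), hi])
          (by simp [hbit j (by omega), hj])
      · exact (key i j k hij hjk).2.2 (by simp [hbit i (by omega), hi])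
          (by simp [hbit j (by omega), hj])

/-- The stepping-up hypergraph of `χ` on `{0, …, V - 1}`. -/
def steppingUpEdges (χ : ℕ → ℕ → Bool) (V : ℕ) : Set (Finset ℕ) :=
  {e | ∃ a b c d p q r, e = {a, b, c, d} ∧ d < V ∧ IsTopBit a b p ∧ IsTopBit b c q ∧
    IsTopBit c d r ∧ StepEdge χ p q r}

theorem card_sorted_quadruple {a b c d : ℕ} (h1 : a < b) (h2 : b < c) (h3 : c < d) :
    #({a, b, c, d} : Finset ℕ) = 4 := by
  have := h1.trans h2
  have := h2.trans h3
  rw [card_insert_of_notMem, card_insert_of_notMem, card_pair h3.ne] <;>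
    simp only [mem_insert, mem_singleton] <;> omega

theorem card_eq_four_and_subset_of_mem_steppingUpEdges {χ : ℕ → ℕ → Bool} {V : ℕ} {e : Finset ℕ}
    (he : e ∈ steppingUpEdges χ V) : #e = 4 ∧ e ⊆ range V := by
  obtain ⟨a, b, c, d, p, q, r, rfl, hd, h1, h2, h3, -⟩ := he
  have h1 := h1.lt
  have h2 := h2.lt
  have h3 := h3.lt
  refine ⟨card_sorted_quadruple h1 h2 h3, fun x hx => ?_⟩
  simp only [mem_insert, mem_singleton] at hx
  exact mem_range.2 (by omega)

theorem stepEdge_of_mem_steppingUpEdges {χ : ℕ → ℕ → Bool} {V a b c d p q r : ℕ}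
    (he : {a, b, c, d} ∈ steppingUpEdges χ V) (h1 : IsTopBit a b p) (h2 : IsTopBit b c q)
    (h3 : IsTopBit c d r) : StepEdge χ p q r := by
  obtain ⟨a', b', c', d', p', q', r', heq, -, h1', h2', h3', hE⟩ := he
  obtain ⟨rfl, rfl, rfl, rfl⟩ :=
    sorted_quadruple_unique h1.lt h2.lt h3.lt h1'.lt h2'.lt h3'.lt heq
  rwa [h1.unique h1', h2.unique h2', h3.unique h3']

theorem not_forall_mem_steppingUpEdges (χ : ℕ → ℕ → Bool) (V : ℕ) {S : Finset ℕ} (hS : #S = 5) :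
    ¬ ∀ e, e ⊆ S → #e = 4 → e ∈ steppingUpEdges χ V := by
  intro hall
  let v : Fin 5 → ℕ := S.orderEmbOfFin hS
  have hv : ∀ i j : Fin 5, i < j → v i < v j := fun i j h => (S.orderEmbOfFin hS).strictMono h
  have hmem : ∀ i, v i ∈ S := S.orderEmbOfFin_mem hS
  obtain ⟨p, hp⟩ := exists_isTopBit (hv 0 1 (by decide))
  obtain ⟨q, hq⟩ := exists_isTopBit (hv 1 2 (by decide))
  obtain ⟨r, hr⟩ := exists_isTopBit (hv 2 3 (by decide))
  obtain ⟨s, hs⟩ := exists_isTopBit (hv 3 4 (by decide))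
  have edge : ∀ i j k l x y z, IsTopBit (v i) (v j) x → IsTopBit (v j) (v k) y →
      IsTopBit (v k) (v l) z → StepEdge χ x y z := fun i j k l x y z h1 h2 h3 =>
    stepEdge_of_mem_steppingUpEdges
      (hall {v i, v j, v k, v l} (by simp [insert_subset_iff, hmem])
        (card_sorted_quadruple h1.lt h2.lt h3.lt)) h1 h2 h3
  have hpq := hp.trans hq
  have hqr := hq.trans hr
  have hrs := hr.trans hs
  exact not_all_stepEdge χ hpq.1 hqr.1 hrs.1 (edge _ _ _ _ _ _ _ hq hr hs)
    (edge _ _ _ _ _ _ _ hpq.2 hr hs) (edge _ _ _ _ _ _ _ hp hqr.2 hs)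
    (edge _ _ _ _ _ _ _ hp hq hrs.2) (edge _ _ _ _ _ _ _ hp hq hr)

theorem isStepIndependent_of_forall_not_subset {χ : ℕ → ℕ → Bool} {V : ℕ} {S : Finset ℕ}
    (hSV : S ⊆ range V) (h : ∀ e ∈ steppingUpEdges χ V, ¬ e ⊆ S) : IsStepIndependent χ S :=
  fun a ha b hb c hc d hd p q r h1 h2 h3 hE =>
    h {a, b, c, d} ⟨a, b, c, d, p, q, r, rfl, mem_range.1 (hSV hd), h1, h2, h3, hE⟩
      (by simp [insert_subset_iff, ha, hb, hc, hd])

theorem exists_hypergraph_of_lt {s n : ℕ} (hn : 7 * (2 * s + 2) ^ 5 < n) :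
    ∃ E : Set (Finset ℕ),
      (∀ e ∈ E, #e = 4 ∧ e ⊆ range (2 ^ 2 ^ s)) ∧
      (∀ S : Finset ℕ, S ⊆ range (2 ^ 2 ^ s) → #S = 5 → ¬ ∀ e, e ⊆ S → #e = 4 → e ∈ E) ∧
      (∀ S : Finset ℕ, S ⊆ range (2 ^ 2 ^ s) → #S = n → ∃ e ∈ E, e ⊆ S) := by
  obtain ⟨χ, hχ⟩ := exists_coloring_cyclic_triple s
  refine ⟨steppingUpEdges χ (2 ^ 2 ^ s),
    fun e => card_eq_four_and_subset_of_mem_steppingUpEdges,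
    fun S _ => not_forall_mem_steppingUpEdges χ _, fun S hSV hS => ?_⟩
  by_contra! h
  have := (isStepIndependent_of_forall_not_subset hSV h).card_le hχ hSV
  omega

theorem exists_exponent_of_twelve_lt {n : ℕ} (hn : 12 < (n : ℝ) ^ ((1 : ℝ) / 5)) :
    ∃ s : ℕ, 7 * (2 * s + 2) ^ 5 < n ∧ 1 / 12 * (n : ℝ) ^ ((1 : ℝ) / 5) ≤ s := by
  set u : ℝ := (n : ℝ) ^ ((1 : ℝ) / 5) with hu
  have hu5 : u ^ 5 = n := by
    rw [hu, ← Real.rpow_natCast, ← Real.rpow_mul n.cast_nonneg]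
    norm_num
  have hfloor : ⌊u / 3⌋₊ ≤ u / 3 := Nat.floor_le (by linarith)
  have hfloor' : u / 3 < ⌊u / 3⌋₊ + 1 := Nat.lt_floor_add_one _
  have hpos : 1 ≤ ⌊u / 3⌋₊ := Nat.le_floor (by push_cast; linarith)
  obtain ⟨s, hs⟩ := Nat.exists_eq_add_of_le' hpos
  rw [hs] at hfloor hfloor'
  push_cast at hfloor hfloor'
  refine ⟨s, ?_, by linarith⟩
  have hpow : (3 * (s + 1 : ℝ)) ^ 5 ≤ n := by
    rw [← hu5]
    exact pow_le_pow_left₀ (by positivity) (by linarith) 5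
  have hpow' : (3 * (s + 1)) ^ 5 ≤ n := by exact_mod_cast hpow
  have : 0 < (s + 1) ^ 5 := by positivity
  calc 7 * (2 * s + 2) ^ 5 = 224 * (s + 1) ^ 5 := by ring
    _ < 243 * (s + 1) ^ 5 := by omega
    _ = (3 * (s + 1)) ^ 5 := by ring
    _ ≤ n := hpow'

end

theorem r4_5_lower_bound :
    ∃ c : ℝ, 0 < c ∧ ∀ n : ℕ, 5 ≤ n →
      ∃ M : ℕ, (2 : ℝ) ^ ((2 : ℝ) ^ (c * (n : ℝ) ^ ((1 : ℝ) / 5))) ≤ (M : ℝ) ∧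
        ∃ E : Set (Finset ℕ),
          (∀ e ∈ E, e.card = 4 ∧ e ⊆ Finset.range (M - 1)) ∧
          (∀ S : Finset ℕ, S ⊆ Finset.range (M - 1) → S.card = 5 →
            ¬ ∀ e, e ⊆ S → e.card = 4 → e ∈ E) ∧
          (∀ S : Finset ℕ, S ⊆ Finset.range (M - 1) → S.card = n →
            ∃ e ∈ E, e ⊆ S) := by
  refine ⟨1 / 12, by norm_num, fun n hn => ?_⟩
  have hmono : ∀ t : ℝ, 1 / 12 * (n : ℝ) ^ ((1 : ℝ) / 5) ≤ t →
      (2 : ℝ) ^ ((2 : ℝ) ^ (1 / 12 * (n : ℝ) ^ ((1 : ℝ) / 5))) ≤ (2 : ℝ) ^ ((2 : ℝ) ^ t) :=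
    fun t ht => Real.rpow_le_rpow_of_exponent_le one_le_two
      (Real.rpow_le_rpow_of_exponent_le one_le_two ht)
  rcases le_or_gt ((n : ℝ) ^ ((1 : ℝ) / 5)) 12 with hu | hu
  · refine ⟨n, (hmono 1 (by linarith)).trans ?_, ∅, by simp, fun S _ hS hall => ?_,
      fun S hSn hS => ?_⟩
    · have : (5 : ℝ) ≤ n := by exact_mod_cast hn
      norm_num
      linarith
    · obtain ⟨e, he, hcard⟩ := Finset.exists_subset_card_eq (show 4 ≤ S.card by omega)
      exact hall e he hcard
    · have := Finset.card_le_card hSn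
      rw [Finset.card_range] at this
      omega
  · obtain ⟨s, hs, hexp⟩ := exists_exponent_of_twelve_lt hu
    refine ⟨2 ^ 2 ^ s + 1, (hmono s hexp).trans ?_, by
      simpa only [Nat.add_sub_cancel] using exists_hypergraph_of_lt hs⟩
    rw [Real.rpow_natCast, show (2 : ℝ) ^ s = ((2 ^ s : ℕ) : ℝ) by push_cast; rfl,
      Real.rpow_natCast]
    push_cast
    linarith
end

section
/- There exists an absolute constant c_0 > 0 such that for every integer n ≥ 5 there is a red/blue coloring φ of the unordered pairs of distinct elements of U = {0,1,...,⌊2^(c_0·n)⌋ − 1} with the property that every n-element subset A ⊆ U contains three elements a < b < c satisfying φ(a,b) = φ(b,c) ≠ φ(a,c). -/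
/-- Prescribing the values of a two-valued function at the points of an injective family
divides the number of such functions by at least `2 ^ (size of the family)`. -/
theorem card_filter_prescribed_mul_two_pow_le {ι κ : Type*} [Fintype ι] [Fintype κ]
    [DecidableEq κ] (g : ι → κ) (hg : Function.Injective g) (v : ι → Bool) :
    (Finset.univ.filter fun χ : κ → Bool => ∀ i, χ (g i) = v i).card * 2 ^ Fintype.card ι
      ≤ 2 ^ Fintype.card κ := by
  classical
  set S : Finset κ := Finset.univ.image g with hS
  have hcard : S.card = Fintype.card ι := by
    rw [hS, Finset.card_image_of_injective _ hg, Finset.card_univ]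
  let t : κ → Finset Bool := fun k => Finset.univ.filter fun w => ∀ i, g i = k → w = v i
  have hsub : (Finset.univ.filter fun χ : κ → Bool => ∀ i, χ (g i) = v i)
      ⊆ Fintype.piFinset t := by
    intro χ hχ
    simp only [Finset.mem_filter, Finset.mem_univ, true_and] at hχ
    simp only [Fintype.mem_piFinset, t, Finset.mem_filter, Finset.mem_univ, true_and]
    rintro k i rfl
    exact hχ i
  have hle : ∀ k, (t k).card ≤ if k ∈ S then 1 else 2 := by
    intro k
    split_ifs with hk
    · obtain ⟨i, -, hi⟩ := Finset.mem_image.1 hk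
      refine Finset.card_le_one.2 fun a ha b hb => ?_
      simp only [t, Finset.mem_filter, Finset.mem_univ, true_and] at ha hb
      rw [ha i hi, hb i hi]
    · exact (Finset.card_le_univ _).trans (by simp)
  have hprod : (Finset.univ.filter fun χ : κ → Bool => ∀ i, χ (g i) = v i).card
      ≤ 2 ^ Sᶜ.card := by
    refine (Finset.card_le_card hsub).trans ?_
    rw [Fintype.card_piFinset]
    refine (Finset.prod_le_prod' fun k _ => hle k).trans (le_of_eq ?_)
    rw [Finset.prod_ite]
    simp [Finset.filter_not, Finset.compl_eq_univ_sdiff]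
  calc _ ≤ 2 ^ Sᶜ.card * 2 ^ S.card := by rw [hcard]; gcongr
    _ = 2 ^ Fintype.card κ := by rw [← pow_add, Finset.card_compl_add_card]

/-- If `N ^ n < 2 ^ (n choose 2)`, some coloring of the pairs of `Fin N` is, along no injective
sequence of length `n`, the indicator of the increasing pairs. -/
theorem exists_coloring_forall_injective_ne (n N : ℕ) (h : N ^ n < 2 ^ n.choose 2) :
    ∃ χ : Sym2 (Fin N) → Bool, ∀ f : Fin n → Fin N, Function.Injective f →
      ∃ i j, i < j ∧ χ s(f i, f j) ≠ decide (f i < f j) := by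
  classical
  let ι := {p : Fin n × Fin n // p.1 < p.2}
  have hι : Fintype.card ι = n.choose 2 := by
    rw [Fintype.card_subtype, Fintype.card_product_filter_lt, Fintype.card_fin]
  by_contra! hcon
  let F : Finset (Fin n → Fin N) := Finset.univ.filter fun f => Function.Injective f
  let E : (Fin n → Fin N) → Finset (Sym2 (Fin N) → Bool) := fun f =>
    Finset.univ.filter fun χ => ∀ p : ι, χ s(f p.1.1, f p.1.2) = decide (f p.1.1 < f p.1.2)
  have hcover : (Finset.univ : Finset (Sym2 (Fin N) → Bool)) ⊆ F.biUnion E := by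
    intro χ _
    obtain ⟨f, hf, hχ⟩ := hcon χ
    simp only [Finset.mem_biUnion, F, E, Finset.mem_filter, Finset.mem_univ, true_and]
    exact ⟨f, hf, fun p => hχ _ _ p.2⟩
  have hE : ∀ f ∈ F, (E f).card * 2 ^ n.choose 2 ≤ 2 ^ Fintype.card (Sym2 (Fin N)) := by
    intro f hf
    have hf : Function.Injective f := by simpa [F] using hf
    rw [← hι]
    refine card_filter_prescribed_mul_two_pow_le (fun p : ι => s(f p.1.1, f p.1.2)) ?_ _
    rintro ⟨⟨a, b⟩, hab⟩ ⟨⟨c, d⟩, hcd⟩ heq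
    simp only [Sym2.eq_iff, hf.eq_iff] at heq hab hcd
    rcases heq with ⟨rfl, rfl⟩ | ⟨rfl, rfl⟩
    · rfl
    · exact absurd hab hcd.asymm
  have hF : F.card ≤ N ^ n := (Finset.card_le_univ _).trans (by simp)
  have hK : 2 ^ Fintype.card (Sym2 (Fin N)) ≤ ∑ f ∈ F, (E f).card := by
    calc _ = (Finset.univ : Finset (Sym2 (Fin N) → Bool)).card := by simp
      _ ≤ _ := (Finset.card_le_card hcover).trans Finset.card_biUnion_le
  have := calc
    2 ^ Fintype.card (Sym2 (Fin N)) * 2 ^ n.choose 2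
        ≤ (∑ f ∈ F, (E f).card) * 2 ^ n.choose 2 := by gcongr
    _ = ∑ f ∈ F, (E f).card * 2 ^ n.choose 2 := Finset.sum_mul ..
    _ ≤ F.card • 2 ^ Fintype.card (Sym2 (Fin N)) := Finset.sum_le_card_nsmul _ _ _ hE
    _ ≤ N ^ n * 2 ^ Fintype.card (Sym2 (Fin N)) := by rw [smul_eq_mul]; gcongr
    _ < 2 ^ n.choose 2 * 2 ^ Fintype.card (Sym2 (Fin N)) := by gcongr
  rw [mul_comm] at this
  exact lt_irrefl _ this

/-- A finite strict total order can be listed increasingly. -/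
theorem exists_equiv_fin_of_isStrictTotalOrder {α : Type*} [Fintype α] (r : α → α → Prop)
    [IsStrictTotalOrder α r] {n : ℕ} (h : Fintype.card α = n) :
    ∃ f : Fin n ≃ α, ∀ i j, i < j → r (f i) (f j) := by
  classical
  let _ : LinearOrder α := linearOrderOfSTO r
  let e := monoEquivOfFin α h
  exact ⟨e.toEquiv, fun i j hij => e.strictMono hij⟩

/-- A coloring of the pairs of a linear order both of whose color classes are transitive on `A`
is the indicator of the increasing pairs along some enumeration of `A`. -/
theorem exists_enumeration_of_transitive_colors {α : Type*} [LinearOrder α] (φ : α → α → Bool)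
    (hsymm : ∀ a b, φ a b = φ b a) (A : Finset α)
    (hA : ∀ a ∈ A, ∀ b ∈ A, ∀ c ∈ A, a < b → b < c → φ a b = φ b c → φ a b = φ a c) :
    ∃ f : Fin A.card ≃ A, ∀ i j, i < j →
      φ (f i) (f j) = decide ((f i : α) < f j) := by
  let r : A → A → Prop := fun x y => x ≠ y ∧ φ x y = decide ((x : α) < y)
  have : IsStrictTotalOrder A r :=
    { trichotomous := by
        rintro ⟨x, hx⟩ ⟨y, hy⟩ h1 h2
        have := hsymm x y
        simp only [r, ne_eq, Subtype.mk.injEq] at h1 h2 ⊢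
        rcases lt_trichotomy x y with a | a | a <;> grind
      irrefl := fun x h => h.1 rfl
      trans := by
        rintro ⟨x, hx⟩ ⟨y, hy⟩ ⟨z, hz⟩ ⟨h1, h2⟩ ⟨h3, h4⟩
        simp only [r, ne_eq, Subtype.mk.injEq] at h1 h2 h3 h4 ⊢
        have hxy := hsymm x y
        have hyz := hsymm y z
        have hxz := hsymm x z
        have hne : x ≠ z := by
          rintro rfl
          rcases lt_or_gt_of_ne h1 with a | a <;> grind
        refine ⟨hne, ?_⟩
        rcases lt_or_gt_of_ne h1 with a | a <;> rcases lt_or_gt_of_ne h3 with b | b <;>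
          rcases lt_or_gt_of_ne hne with c | c <;> grind }
  obtain ⟨f, hf⟩ := exists_equiv_fin_of_isStrictTotalOrder r (Fintype.card_coe A)
  exact ⟨f, fun i j hij => (hf i j hij).2⟩

/-- Sets of size `⌊2 ^ (n / 4)⌋` are small enough for the first moment bound. -/
theorem floor_two_rpow_pow_lt_two_pow_choose {n : ℕ} (hn : 5 ≤ n) :
    ⌊(2 : ℝ) ^ ((1 / 4 : ℝ) * (n : ℝ))⌋₊ ^ n < 2 ^ n.choose 2 := by
  set N := ⌊(2 : ℝ) ^ ((1 / 4 : ℝ) * (n : ℝ))⌋₊ with hN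
  have h4 : N ^ 4 ≤ 2 ^ n := by
    have h : (N : ℝ) ≤ (2 : ℝ) ^ ((1 / 4 : ℝ) * (n : ℝ)) := Nat.floor_le (by positivity)
    have h' : (N : ℝ) ^ 4 ≤ 2 ^ n := by
      calc (N : ℝ) ^ 4 ≤ ((2 : ℝ) ^ ((1 / 4 : ℝ) * (n : ℝ))) ^ 4 := by gcongr
        _ = 2 ^ n := by
          rw [← Real.rpow_natCast, ← Real.rpow_mul (by norm_num), ← Real.rpow_natCast]
          congr 1
          push_cast
          ring
    exact_mod_cast h'
  have hM : n * n < 4 * n.choose 2 := by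
    have h2 : n.choose 2 * 2 = n * (n - 1) := by
      rw [← Finset.sum_range_id_mul_two, Finset.sum_range_id, Nat.choose_two_right]
    obtain ⟨m, rfl⟩ : ∃ m, n = m + 1 := ⟨n - 1, by omega⟩
    simp only [Nat.add_sub_cancel] at h2
    nlinarith
  refine lt_of_pow_lt_pow_left₀ 4 (by positivity) ?_
  calc (N ^ n) ^ 4 = (N ^ 4) ^ n := by rw [← pow_mul, ← pow_mul, mul_comm]
    _ ≤ (2 ^ n) ^ n := by gcongr
    _ = 2 ^ (n * n) := by rw [← pow_mul]
    _ < 2 ^ (4 * n.choose 2) := Nat.pow_lt_pow_right (by norm_num) hM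
    _ = (2 ^ n.choose 2) ^ 4 := by rw [← pow_mul, mul_comm]

theorem exists_good_coloring :
    ∃ c₀ : ℝ, 0 < c₀ ∧ ∀ n : ℕ, 5 ≤ n →
      ∃ φ : ℕ → ℕ → Bool, (∀ a b, φ a b = φ b a) ∧
        ∀ A : Finset ℕ, A ⊆ Finset.range ⌊(2 : ℝ) ^ (c₀ * (n : ℝ))⌋₊ → A.card = n →
          ∃ a ∈ A, ∃ b ∈ A, ∃ c ∈ A,
            a < b ∧ b < c ∧ φ a b = φ b c ∧ φ a b ≠ φ a c := by
  refine ⟨1 / 4, by norm_num, fun n hn => ?_⟩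
  have hlt := floor_two_rpow_pow_lt_two_pow_choose hn
  set N := ⌊(2 : ℝ) ^ ((1 / 4 : ℝ) * (n : ℝ))⌋₊
  obtain ⟨χ, hχ⟩ := exists_coloring_forall_injective_ne n N hlt
  let φ : ℕ → ℕ → Bool := fun a b =>
    if h : a < N ∧ b < N then χ s(⟨a, h.1⟩, ⟨b, h.2⟩) else false
  have hsymm : ∀ a b, φ a b = φ b a := by
    intro a b
    simp only [φ, and_comm (a := a < N), Sym2.eq_swap]
  refine ⟨φ, hsymm, fun A hA hcard => ?_⟩
  by_contra! hcon
  subst hcard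
  obtain ⟨f, hf⟩ := exists_enumeration_of_transitive_colors φ hsymm A hcon
  have hmem : ∀ i, (f i : ℕ) < N := fun i => Finset.mem_range.1 (hA (f i).2)
  obtain ⟨i, j, hij, hne⟩ := hχ (fun i => ⟨f i, hmem i⟩) fun i j h =>
    f.injective (Subtype.ext (Fin.mk.inj_iff.1 h))
  refine hne ?_
  have := hf i j hij
  simpa [φ, hmem] using this
end

section
/- For every N ≥ 1 and every symmetric 2-coloring φ of pairs of distinct natural numbers less than N, the 4-uniform hypergraph H is K_5^(4)-free: there is no 5-element subset of {0,1,...,2^N − 1} all five of whose 4-element subsets are edges of H. -/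
/-- For distinct natural numbers `a` and `b`, `delta a b` is the largest index `i`
such that the `i`-th binary digits of `a` and `b` differ (the position of the
highest set bit of `a XOR b`). -/
def delta (a b : ℕ) : ℕ := Nat.log 2 (a ^^^ b)

/-- The edge predicate of the 4-uniform hypergraph `H` determined by a symmetric
2-coloring `φ` of pairs: for `v₁ < v₂ < v₃ < v₄` with `δᵢ = delta vᵢ v_{i+1}`,
`(v₁,v₂,v₃,v₄)` is an edge iff one of the conditions (i), (ii), (iii) holds. -/
def IsEdge (φ : ℕ → ℕ → Bool) (v₁ v₂ v₃ v₄ : ℕ) : Prop :=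
  (((delta v₁ v₂ < delta v₂ v₃ ∧ delta v₂ v₃ < delta v₃ v₄) ∨
    (delta v₂ v₃ < delta v₁ v₂ ∧ delta v₃ v₄ < delta v₂ v₃)) ∧
    φ (delta v₁ v₂) (delta v₂ v₃) = φ (delta v₂ v₃) (delta v₃ v₄) ∧
    φ (delta v₁ v₂) (delta v₂ v₃) ≠ φ (delta v₁ v₂) (delta v₃ v₄)) ∨
  (delta v₂ v₃ < delta v₁ v₂ ∧ delta v₂ v₃ < delta v₃ v₄ ∧
    delta v₃ v₄ < delta v₁ v₂ ∧
    φ (delta v₁ v₂) (delta v₂ v₃) ≠ φ (delta v₂ v₃) (delta v₃ v₄)) ∨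
  (delta v₂ v₃ < delta v₁ v₂ ∧ delta v₂ v₃ < delta v₃ v₄ ∧
    delta v₁ v₂ < delta v₃ v₄ ∧
    φ (delta v₁ v₂) (delta v₂ v₃) = φ (delta v₁ v₂) (delta v₃ v₄) ∧
    φ (delta v₁ v₂) (delta v₃ v₄) = φ (delta v₂ v₃) (delta v₃ v₄))

theorem delta_lt_iff {a b : ℕ} (h : a ≠ b) (k : ℕ) :
    delta a b < k ↔ a / 2 ^ k = b / 2 ^ k := by
  have hne : a ^^^ b ≠ 0 := by simpa using h
  rw [delta, Nat.log_lt_iff_lt_pow Nat.one_lt_two hne, ← Nat.div_eq_zero_iff_lt (by positivity),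
    ← Nat.shiftRight_eq_div_pow, Nat.shiftRight_xor_distrib, Nat.xor_eq_zero_iff,
    Nat.shiftRight_eq_div_pow, Nat.shiftRight_eq_div_pow]

theorem delta_eq_max {a b c : ℕ} (hab : a < b) (hbc : b < c) :
    delta a c = max (delta a b) (delta b c) := by
  refine eq_of_forall_gt_iff fun k => ?_
  rw [max_lt_iff, delta_lt_iff (by omega), delta_lt_iff (by omega), delta_lt_iff (by omega)]
  have h₁ := Nat.div_le_div_right (c := 2 ^ k) hab.le
  have h₂ := Nat.div_le_div_right (c := 2 ^ k) hbc.le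
  omega

theorem delta_ne_delta {a b c : ℕ} (hab : a < b) (hbc : b < c) :
    delta a b ≠ delta b c := by
  intro h
  have h₁ := delta_lt_iff hab.ne (delta a b)
  have h₂ := delta_lt_iff hbc.ne (delta a b)
  have h₃ := delta_lt_iff hab.ne (delta a b + 1)
  have h₄ := delta_lt_iff hbc.ne (delta a b + 1)
  have h₅ := Nat.div_le_div_right (c := 2 ^ delta a b) hab.le
  have h₆ := Nat.div_le_div_right (c := 2 ^ delta a b) hbc.le
  simp only [pow_succ, ← Nat.div_div_eq_div_mul] at h₃ h₄
  omega

theorem H_is_K5_free (N : ℕ) (hN : 1 ≤ N) (φ : ℕ → ℕ → Bool)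
    (hsym : ∀ a b, φ a b = φ b a) :
    ¬ ∃ v₁ v₂ v₃ v₄ v₅ : ℕ,
        v₁ < v₂ ∧ v₂ < v₃ ∧ v₃ < v₄ ∧ v₄ < v₅ ∧ v₅ < 2 ^ N ∧
        IsEdge φ v₁ v₂ v₃ v₄ ∧ IsEdge φ v₁ v₂ v₃ v₅ ∧ IsEdge φ v₁ v₂ v₄ v₅ ∧
        IsEdge φ v₁ v₃ v₄ v₅ ∧ IsEdge φ v₂ v₃ v₄ v₅ := by
  rintro ⟨v₁, v₂, v₃, v₄, v₅, h₁₂, h₂₃, h₃₄, h₄₅, -, e₅, e₄, e₃, e₂, e₁⟩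
  have n₁ := delta_ne_delta h₁₂ h₂₃
  have n₂ := delta_ne_delta h₂₃ h₃₄
  have n₃ := delta_ne_delta h₃₄ h₄₅
  have n₄ := delta_ne_delta (h₁₂.trans h₂₃) h₃₄
  have n₅ := delta_ne_delta (h₂₃.trans h₃₄) h₄₅
  have n₆ := delta_ne_delta h₁₂ (h₂₃.trans h₃₄)
  have n₇ := delta_ne_delta h₂₃ (h₃₄.trans h₄₅)
  have n₈ := delta_ne_delta (h₁₂.trans (h₂₃.trans h₃₄)) h₄₅
  simp only [IsEdge, delta_eq_max h₁₂ h₂₃, delta_eq_max h₂₃ h₃₄, delta_eq_max h₃₄ h₄₅,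
    delta_eq_max (h₁₂.trans h₂₃) h₃₄] at *
  generalize delta v₁ v₂ = a at *
  generalize delta v₂ v₃ = b at *
  generalize delta v₃ v₄ = c at *
  generalize delta v₄ v₅ = d at *
  have s₁ := hsym a b
  have s₂ := hsym a c
  have s₃ := hsym a d
  have s₄ := hsym b c
  have s₅ := hsym b d
  have s₆ := hsym c d
  have t₁ := Bool.eq_false_or_eq_true (φ a b)
  have t₂ := Bool.eq_false_or_eq_true (φ a c)
  have t₃ := Bool.eq_false_or_eq_true (φ a d)
  have t₄ := Bool.eq_false_or_eq_true (φ b c)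
  have t₅ := Bool.eq_false_or_eq_true (φ b d)
  have t₆ := Bool.eq_false_or_eq_true (φ c d)
  clear hsym h₁₂ h₂₃ h₃₄ h₄₅
  rcases lt_or_gt_of_ne n₁ with h₁ | h₁ <;> rcases lt_or_gt_of_ne n₂ with h₂ | h₂ <;>
    rcases lt_or_gt_of_ne n₃ with h₃ | h₃ <;>
    grind
end

section
/- For every N ≥ 1 and every symmetric 2-coloring φ of pairs of distinct natural numbers less than N: there is no 5-element subset P = (v_1 < v_2 < v_3 < v_4 < v_5) of {0,1,...,2^N − 1}, all five of whose 4-element subsets are edges of H, whose δ-sequence satisfies δ_1 > δ_2 < δ_3 < δ_4 (where δ_i = δ(v_i, v_{i+1})). -/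
theorem Nat.log_two_xor_of_lt {p q : ℕ} (h : Nat.log 2 p < Nat.log 2 q) :
    Nat.log 2 (p ^^^ q) = Nat.log 2 q := by
  have hq : q ≠ 0 := by
    rintro rfl
    simp at h
  have hp : p < 2 ^ Nat.log 2 q := Nat.lt_pow_of_log_lt one_lt_two h
  have hq_lt : q < 2 ^ (Nat.log 2 q + 1) := Nat.lt_pow_succ_log_self one_lt_two q
  have hq_le : 2 ^ Nat.log 2 q ≤ q := Nat.pow_log_le_self 2 hq
  refine Nat.log_eq_of_pow_le_of_lt_pow ?_ ?_
  · by_contra! hlt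
    have hxor := Nat.xor_lt_two_pow hp hlt
    rw [Nat.xor_xor_cancel_left] at hxor
    exact absurd hxor (not_lt.mpr hq_le)
  · exact Nat.xor_lt_two_pow (hp.trans (Nat.pow_lt_pow_succ one_lt_two)) hq_lt

theorem delta_eq_of_delta_lt {x y z : ℕ} (h : delta x y < delta y z) :
    delta x z = delta y z := by
  have hxz : x ^^^ z = (x ^^^ y) ^^^ (y ^^^ z) := by
    rw [Nat.xor_assoc, Nat.xor_xor_cancel_left]
  unfold delta at *
  rw [hxz, Nat.log_two_xor_of_lt h]

theorem K5_delta_no_min_at_two (N : ℕ) (hN : 1 ≤ N) (φ : ℕ → ℕ → Bool)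
    (hsym : ∀ a b, φ a b = φ b a) :
    ¬ ∃ v₁ v₂ v₃ v₄ v₅ : ℕ,
        v₁ < v₂ ∧ v₂ < v₃ ∧ v₃ < v₄ ∧ v₄ < v₅ ∧ v₅ < 2 ^ N ∧
        IsEdge φ v₁ v₂ v₃ v₄ ∧ IsEdge φ v₁ v₂ v₃ v₅ ∧ IsEdge φ v₁ v₂ v₄ v₅ ∧
        IsEdge φ v₁ v₃ v₄ v₅ ∧ IsEdge φ v₂ v₃ v₄ v₅ ∧
        delta v₂ v₃ < delta v₁ v₂ ∧ delta v₂ v₃ < delta v₃ v₄ ∧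
        delta v₃ v₄ < delta v₄ v₅ := by
  rintro ⟨v₁, v₂, v₃, v₄, v₅, -, -, -, -, -, h1234, h1235, h1245, -, h2345, hba, hbc, hcd⟩
  have h24 : delta v₂ v₄ = delta v₃ v₄ := delta_eq_of_delta_lt hbc
  have h35 : delta v₃ v₅ = delta v₄ v₅ := delta_eq_of_delta_lt hcd
  unfold IsEdge at *
  rw [h35] at h1235
  rw [h24] at h1245
  generalize delta v₁ v₂ = a at *
  generalize delta v₂ v₃ = b at *
  generalize delta v₃ v₄ = c at *
  generalize delta v₄ v₅ = d at *
  clear hsym h24 h35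
  have hbool : φ a b ≠ φ b c → φ a b ≠ φ b d → φ b c = φ b d := by
    cases φ a b <;> cases φ b c <;> cases φ b d <;> simp
  grind
end

section
/- For every N ≥ 1 and every symmetric 2-coloring φ of pairs of distinct natural numbers less than N: there is no 5-element subset P = (v_1 < v_2 < v_3 < v_4 < v_5) of {0,1,...,2^N − 1}, all five of whose 4-element subsets are edges of H, whose δ-sequence satisfies δ_1 > δ_2 > δ_3 < δ_4 (where δ_i = δ(v_i, v_{i+1})). -/
theorem Nat.log_two_xor_of_log_lt {x y : ℕ} (h : Nat.log 2 x < Nat.log 2 y) :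
    Nat.log 2 (x ^^^ y) = Nat.log 2 y := by
  have hy : y ≠ 0 := by
    rintro rfl
    simp at h
  have hx : x < 2 ^ Nat.log 2 y := Nat.lt_pow_of_log_lt one_lt_two h
  have hy_lt : y < 2 ^ (Nat.log 2 y + 1) := Nat.lt_pow_succ_log_self one_lt_two y
  refine Nat.log_eq_of_pow_le_of_lt_pow ?_ ?_
  · apply Nat.ge_two_pow_of_testBit
    rw [Nat.testBit_xor, Nat.testBit_lt_two_pow hx, ← Nat.log2_eq_log_two,
      Nat.testBit_log2 hy]
    rfl
  · exact Nat.xor_lt_two_pow (hx.trans (Nat.pow_lt_pow_right one_lt_two (Nat.lt_succ_self _)))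
      hy_lt

theorem delta_eq_right_of_lt {a b c : ℕ} (h : delta a b < delta b c) :
    delta a c = delta b c := by
  have hxor : a ^^^ c = (a ^^^ b) ^^^ (b ^^^ c) := by
    rw [Nat.xor_assoc, Nat.xor_xor_cancel_left]
  unfold delta at *
  rw [hxor, Nat.log_two_xor_of_log_lt h]

theorem delta_comm (a b : ℕ) : delta a b = delta b a := by
  rw [delta, Nat.xor_comm, delta]

theorem delta_eq_left_of_lt {a b c : ℕ} (h : delta b c < delta a b) :
    delta a c = delta a b := by
  rw [delta_comm a c, delta_comm a b]
  rw [delta_comm b c, delta_comm a b] at h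
  exact delta_eq_right_of_lt h

theorem K5_delta_no_min_at_three (N : ℕ) (hN : 1 ≤ N) (φ : ℕ → ℕ → Bool)
    (hsym : ∀ a b, φ a b = φ b a) :
    ¬ ∃ v₁ v₂ v₃ v₄ v₅ : ℕ,
        v₁ < v₂ ∧ v₂ < v₃ ∧ v₃ < v₄ ∧ v₄ < v₅ ∧ v₅ < 2 ^ N ∧
        IsEdge φ v₁ v₂ v₃ v₄ ∧ IsEdge φ v₁ v₂ v₃ v₅ ∧ IsEdge φ v₁ v₂ v₄ v₅ ∧
        IsEdge φ v₁ v₃ v₄ v₅ ∧ IsEdge φ v₂ v₃ v₄ v₅ ∧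
        delta v₂ v₃ < delta v₁ v₂ ∧ delta v₃ v₄ < delta v₂ v₃ ∧
        delta v₃ v₄ < delta v₄ v₅ := by
  rintro ⟨v₁, v₂, v₃, v₄, v₅, -, -, -, -, -, h₁₂₃₄, -, h₁₂₄₅, h₁₃₄₅, h₂₃₄₅, h₁₂, h₂₃, h₃₄⟩
  have h₁₃ := delta_eq_left_of_lt h₁₂
  have h₂₄ := delta_eq_left_of_lt h₂₃
  unfold IsEdge at h₁₂₃₄ h₁₂₄₅ h₁₃₄₅ h₂₃₄₅
  rw [h₂₄] at h₁₂₄₅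
  rw [h₁₃] at h₁₃₄₅
  generalize delta v₁ v₂ = a at *
  generalize delta v₂ v₃ = b at *
  generalize delta v₃ v₄ = c at *
  generalize delta v₄ v₅ = d at *
  clear h₁₃ h₂₄
  cases hac : φ a c <;> cases hbc : φ b c <;> cases hcd : φ c d <;> grind
end

section
/- Let n ≥ 5, N ≥ 1, and let φ be a symmetric 2-coloring of pairs of distinct natural numbers less than N such that every n-element subset A of {0,1,...,N−1} contains elements a < b < c with φ(a,b) = φ(b,c) ≠ φ(a,c). Let Q = (v_1 < v_2 < ... < v_m) be a subset of {0,1,...,2^N − 1} that is independent in H (contains no edge of H), and set δ_i = δ(v_i, v_{i+1}) for 1 ≤ i ≤ m−1. Then there is no strictly monotone subsequence δ_{i_1}, δ_{i_2}, ..., δ_{i_n} (with i_1 < i_2 < ... < i_n, and either δ_{i_1} < ... < δ_{i_n} or δ_{i_1} > ... > δ_{i_n}) such that for every triple of indices a < b < c in {1,...,n} there exist vertices u_1 < u_2 < u_3 < u_4 in Q with δ(u_1,u_2) = δ_{i_a}, δ(u_2,u_3) = δ_{i_b}, δ(u_3,u_4) = δ_{i_c} if the subsequence is increasing (respectively δ(u_1,u_2)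 = δ_{i_c}, δ(u_2,u_3) = δ_{i_b}, δ(u_3,u_4) = δ_{i_a} if decreasing). -/
/-- The `δ`-sequence of an increasing sequence of vertices `v`:
`dseq v i = delta (v i) (v (i+1))`. -/
def dseq (v : ℕ → ℕ) (i : ℕ) : ℕ := delta (v i) (v (i + 1))

theorem delta_lt_of_lt_two_pow {N a b : ℕ} (hN : 1 ≤ N) (ha : a < 2 ^ N) (hb : b < 2 ^ N) :
    delta a b < N := by
  have hx : a ^^^ b < 2 ^ N := Nat.xor_lt_two_pow ha hb
  rcases Nat.eq_zero_or_pos (a ^^^ b) with h | h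
  · simpa [delta, h] using Nat.succ_le_iff.1 hN
  · exact Nat.log_lt_of_lt_pow h.ne' hx

/-- A coloring with a bad triple in every `n`-subset of `range N` has one in the range of
any injective `d : {0, …, n - 1} → {0, …, N - 1}`, indexed so that `d` increases along it. -/
theorem exists_bad_triple_of_injOn {n N : ℕ} {φ : ℕ → ℕ → Bool}
    (hφ : ∀ A : Finset ℕ, A ⊆ Finset.range N → A.card = n →
      ∃ a ∈ A, ∃ b ∈ A, ∃ c ∈ A, a < b ∧ b < c ∧ φ a b = φ b c ∧ φ a b ≠ φ a c)
    (d : ℕ → ℕ) (hd : ∀ a < n, d a < N) (hinj : ∀ a b, a < b → b < n → d a ≠ d b) :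
    ∃ a < n, ∃ b < n, ∃ c < n, d a < d b ∧ d b < d c ∧
      φ (d a) (d b) = φ (d b) (d c) ∧ φ (d a) (d b) ≠ φ (d a) (d c) := by
  have hcard : ((Finset.range n).image d).card = n := by
    rw [Finset.card_image_of_injOn, Finset.card_range]
    intro a ha b hb hab
    simp only [Finset.coe_range, Set.mem_Iio] at ha hb
    rcases lt_trichotomy a b with h | h | h
    · exact absurd hab (hinj a b h hb)
    · exact h
    · exact absurd hab.symm (hinj b a h ha)
  have hsub : (Finset.range n).image d ⊆ Finset.range N := by
    intro x hx
    obtain ⟨a, ha, rfl⟩ := Finset.mem_image.1 hx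
    exact Finset.mem_range.2 (hd a (Finset.mem_range.1 ha))
  simpa only [Finset.exists_mem_image, Finset.mem_range] using hφ _ hsub hcard

theorem no_good_monotone_subsequence (n N m : ℕ) (hn : 5 ≤ n) (hN : 1 ≤ N)
    (φ : ℕ → ℕ → Bool) (hsym : ∀ a b, φ a b = φ b a)
    (hφ : ∀ A : Finset ℕ, A ⊆ Finset.range N → A.card = n →
      ∃ a ∈ A, ∃ b ∈ A, ∃ c ∈ A, a < b ∧ b < c ∧ φ a b = φ b c ∧ φ a b ≠ φ a c)
    (v : ℕ → ℕ) (hv : ∀ i j, i < j → j < m → v i < v j)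
    (hvN : ∀ i, i < m → v i < 2 ^ N)
    (hind : ∀ i j k l, i < j → j < k → k < l → l < m →
      ¬ IsEdge φ (v i) (v j) (v k) (v l)) :
    ¬ ∃ idx : ℕ → ℕ,
        (∀ a b, a < b → b < n → idx a < idx b) ∧
        (∀ a, a < n → idx a < m - 1) ∧
        (((∀ a b, a < b → b < n → dseq v (idx a) < dseq v (idx b)) ∧
          (∀ a b c, a < b → b < c → c < n →
            ∃ p q r s, p < q ∧ q < r ∧ r < s ∧ s < m ∧
              delta (v p) (v q) = dseq v (idx a) ∧
              delta (v q) (v r) = dseq v (idx b) ∧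
              delta (v r) (v s) = dseq v (idx c))) ∨
         ((∀ a b, a < b → b < n → dseq v (idx b) < dseq v (idx a)) ∧
          (∀ a b c, a < b → b < c → c < n →
            ∃ p q r s, p < q ∧ q < r ∧ r < s ∧ s < m ∧
              delta (v p) (v q) = dseq v (idx c) ∧
              delta (v q) (v r) = dseq v (idx b) ∧
              delta (v r) (v s) = dseq v (idx a)))) := by
  rintro ⟨idx, -, hidx, h⟩
  have hd : ∀ a < n, dseq v (idx a) < N := fun a ha =>
    have := hidx a ha
    delta_lt_of_lt_two_pow hN (hvN (idx a) (by omega)) (hvN (idx a + 1) (by omega))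
  rcases h with ⟨hmono, hex⟩ | ⟨hanti, hex⟩
  · obtain ⟨a, ha, b, hb, c, hc, hab, hbc, h₁, h₂⟩ :=
      exists_bad_triple_of_injOn hφ (fun a => dseq v (idx a)) hd
        fun a b hab hb => (hmono a b hab hb).ne
    have lt_of : ∀ x y, x < n → dseq v (idx x) < dseq v (idx y) → x < y := by
      intro x y hx hxy
      rcases lt_trichotomy x y with h | rfl | h
      · exact h
      · exact absurd hxy (lt_irrefl _)
      · exact absurd hxy (hmono y x h hx).asymm
    obtain ⟨p, q, r, s, hpq, hqr, hrs, hs, e₁, e₂, e₃⟩ :=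
      hex a b c (lt_of a b ha hab) (lt_of b c hb hbc) hc
    refine hind p q r s hpq hqr hrs hs (Or.inl ?_)
    rw [e₁, e₂, e₃]
    exact ⟨Or.inl ⟨hab, hbc⟩, h₁, h₂⟩
  · obtain ⟨a, ha, b, hb, c, hc, hab, hbc, h₁, h₂⟩ :=
      exists_bad_triple_of_injOn hφ (fun a => dseq v (idx a)) hd
        fun a b hab hb => (hanti a b hab hb).ne'
    have lt_of : ∀ x y, y < n → dseq v (idx x) < dseq v (idx y) → y < x := by
      intro x y hy hxy
      rcases lt_trichotomy y x with h | rfl | h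
      · exact h
      · exact absurd hxy (lt_irrefl _)
      · exact absurd hxy (hanti x y h hy).asymm
    obtain ⟨p, q, r, s, hpq, hqr, hrs, hs, e₁, e₂, e₃⟩ :=
      hex c b a (lt_of b c hc hbc) (lt_of a b hb hab) ha
    refine hind p q r s hpq hqr hrs hs (Or.inl ?_)
    rw [e₁, e₂, e₃]
    exact ⟨Or.inl ⟨hab, hbc⟩, h₁, h₂⟩
end

section
/- Let v_1 < v_2 < ... < v_m be natural numbers and set δ_i = δ(v_i, v_{i+1}) for 1 ≤ i ≤ m−1. Suppose a < b < c are indices in {1,...,m−1} with δ_a < δ_b < δ_c, with δ_x < δ_b for all a < x < b, and with δ_x < δ_c for all b < x < c. Then the 4-tuple v_a < v_{a+1} < v_{b+1} < v_{c+1} satisfies δ(v_a, v_{a+1}) = δ_a, δ(v_{a+1}, v_{b+1}) = δ_b, and δ(v_{b+1}, v_{c+1}) = δ_c. -/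
theorem xor_xor_xor_cancel_middle (x y z : ℕ) : (x ^^^ y) ^^^ (y ^^^ z) = x ^^^ z := by
  rw [Nat.xor_assoc, ← Nat.xor_assoc y y z, Nat.xor_self, Nat.zero_xor]

theorem log_two_xor_eq_right {s t : ℕ} (ht : t ≠ 0) (hs : s < 2 ^ Nat.log 2 t) :
    Nat.log 2 (s ^^^ t) = Nat.log 2 t := by
  refine Nat.log_eq_of_pow_le_of_lt_pow ?_ ?_
  · by_contra! h
    have hlt := Nat.xor_lt_two_pow hs h
    rw [← Nat.xor_assoc, Nat.xor_self, Nat.zero_xor] at hlt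
    exact absurd (Nat.pow_log_le_self 2 ht) (not_le.mpr hlt)
  · exact Nat.xor_lt_two_pow (hs.trans (Nat.pow_lt_pow_right one_lt_two (Nat.lt_succ_self _)))
      (Nat.lt_pow_succ_log_self one_lt_two t)

theorem xor_lt_two_pow_of_dseq_lt (v : ℕ → ℕ) {p q k : ℕ} (hpq : p ≤ q)
    (h : ∀ x, p ≤ x → x < q → dseq v x < k) : v p ^^^ v q < 2 ^ k := by
  induction q, hpq using Nat.le_induction with
  | base => simp
  | succ q hpq ih =>
    rw [← xor_xor_xor_cancel_middle (v p) (v q)]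
    exact Nat.xor_lt_two_pow (ih fun x hx hxq => h x hx (by omega))
      (Nat.lt_pow_of_log_lt one_lt_two (h q hpq (Nat.lt_succ_self q)))

theorem delta_eq_dseq_of_dseq_lt (v : ℕ → ℕ) {p q : ℕ} (hpq : p ≤ q) (hne : v q ≠ v (q + 1))
    (h : ∀ x, p ≤ x → x < q → dseq v x < dseq v q) : delta (v p) (v (q + 1)) = dseq v q := by
  unfold delta
  rw [← xor_xor_xor_cancel_middle (v p) (v q)]
  exact log_two_xor_eq_right (Nat.xor_ne_zero_iff.mpr hne) (xor_lt_two_pow_of_dseq_lt v hpq h)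

theorem delta_of_selected_tuple (m : ℕ) (v : ℕ → ℕ)
    (hv : ∀ i j, i < j → j < m → v i < v j)
    (a b c : ℕ) (hab : a < b) (hbc : b < c) (hc : c < m - 1)
    (hd1 : dseq v a < dseq v b) (hd2 : dseq v b < dseq v c)
    (hx1 : ∀ x, a < x → x < b → dseq v x < dseq v b)
    (hx2 : ∀ x, b < x → x < c → dseq v x < dseq v c) :
    v a < v (a + 1) ∧ v (a + 1) < v (b + 1) ∧ v (b + 1) < v (c + 1) ∧
    delta (v a) (v (a + 1)) = dseq v a ∧
    delta (v (a + 1)) (v (b + 1)) = dseq v b ∧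
    delta (v (b + 1)) (v (c + 1)) = dseq v c := by
  refine ⟨hv _ _ (by omega) (by omega), hv _ _ (by omega) (by omega),
    hv _ _ (by omega) (by omega), rfl, ?_, ?_⟩
  · exact delta_eq_dseq_of_dseq_lt v hab (hv _ _ (by omega) (by omega)).ne
      fun x hx => hx1 x hx
  · exact delta_eq_dseq_of_dseq_lt v hbc (hv _ _ (by omega) (by omega)).ne
      fun x hx => hx2 x hx
end

section
/- Let v_1 < v_2 < ... < v_m be natural numbers, set δ_i = δ(v_i, v_{i+1}) for 1 ≤ i ≤ m−1, and let I = {i_1 < i_2 < ... < i_k} ⊆ {1,...,m−1} be a set of indices satisfying property (∗): for every two consecutive elements i_j < i_{j+1} of I, δ_x < max(δ_{i_j}, δ_{i_{j+1}}) for all i_j < x < i_{j+1}. Let J ⊆ I be the set of local maxima of I, i.e., J = { i_j : 1 < j < k and δ_{i_{j−1}} < δ_{i_j} > δ_{i_{j+1}} }. Then J also satisfies property (∗): for every two consecutive elements a < b of J, δ_x < max(δ_a, δ_b) for all a < x < b; moreover δ_a ≠ δ_b for every two consecutive elements a < b of J. -/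
theorem testBit_eq_of_delta_lt {a b i : ℕ} (h : delta a b < i) :
    a.testBit i = b.testBit i := by
  have hlt : a ^^^ b < 2 ^ i := Nat.lt_pow_of_log_lt (by norm_num) h
  have hbit := Nat.testBit_lt_two_pow hlt
  rw [Nat.testBit_xor] at hbit
  simpa using hbit

theorem testBit_delta_of_lt {a b : ℕ} (h : a < b) :
    a.testBit (delta a b) = false ∧ b.testBit (delta a b) = true := by
  have hne : a ^^^ b ≠ 0 := by
    rw [Ne, Nat.xor_eq_zero_iff]
    exact h.ne
  have hbit : (a ^^^ b).testBit (delta a b) = true := by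
    rw [delta, ← Nat.log2_eq_log_two]
    exact Nat.testBit_log2 hne
  rw [Nat.testBit_xor] at hbit
  cases ha : a.testBit (delta a b) <;> cases hb : b.testBit (delta a b)
  · simp [ha, hb] at hbit
  · exact ⟨rfl, rfl⟩
  · have hba : b < a := Nat.lt_of_testBit _ hb ha fun j hj => (testBit_eq_of_delta_lt hj).symm
    omega
  · simp [ha, hb] at hbit

/-- Between two equal values of the `δ`-sequence there is a value at least as large. -/
theorem dseq_ne_of_forall_between_lt {v : ℕ → ℕ} {x y : ℕ} (hxy : x < y)
    (hx : v x < v (x + 1)) (hy : v y < v (y + 1))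
    (hlt : ∀ z, x < z → z < y → dseq v z < dseq v x) : dseq v x ≠ dseq v y := by
  intro heq
  have htrue : ∀ z, x + 1 ≤ z → z ≤ y → (v z).testBit (dseq v x) = true := by
    intro z hz
    induction z, hz using Nat.le_induction with
    | base => exact fun _ => (testBit_delta_of_lt hx).2
    | succ z hz ih =>
      intro hzy
      rw [← testBit_eq_of_delta_lt (hlt z (by omega) (by omega))]
      exact ih (by omega)
  have hfalse : (v y).testBit (dseq v y) = false := (testBit_delta_of_lt hy).1
  rw [← heq, htrue y hxy le_rfl] at hfalse
  cases hfalse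

/-- A sequence without equal neighbours that has no local maximum strictly between `p` and `q`
is bounded there by the larger of its values at `p` and `q`. -/
theorem lt_max_of_no_local_max {d : ℕ → ℕ} {p q : ℕ}
    (hne : ∀ e, p ≤ e → e < q → d e ≠ d (e + 1))
    (hno : ∀ e, p < e → e < q → ¬ (d (e - 1) < d e ∧ d (e + 1) < d e)) :
    ∀ e, p < e → e < q → d e < max (d p) (d q) := by
  intro e hpe heq
  by_contra! hle
  obtain ⟨c, hc, hmax⟩ := Finset.exists_max_image (Finset.Ioo p q) d
    ⟨e, Finset.mem_Ioo.2 ⟨hpe, heq⟩⟩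
  rw [Finset.mem_Ioo] at hc
  have hec := hmax e (Finset.mem_Ioo.2 ⟨hpe, heq⟩)
  have hbound : ∀ f, p ≤ f → f ≤ q → d f ≤ d c := by
    intro f hpf hfq
    rcases hpf.eq_or_lt with rfl | hpf
    · exact (le_max_left _ _).trans (hle.trans hec)
    rcases hfq.eq_or_lt with rfl | hfq
    · exact (le_max_right _ _).trans (hle.trans hec)
    exact hmax f (Finset.mem_Ioo.2 ⟨hpf, hfq⟩)
  have hleft := hne (c - 1) (by omega) (by omega)
  rw [Nat.sub_add_cancel (by omega)] at hleft
  exact hno c hc.1 hc.2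
    ⟨lt_of_le_of_ne (hbound _ (by omega) (by omega)) hleft,
      lt_of_le_of_ne (hbound _ (by omega) (by omega)) (hne c hc.1.le hc.2).symm⟩

/-- A point between two terms of a sequence is a term or lies between consecutive terms. -/
theorem exists_eq_or_between {f : ℕ → ℕ} {p q x : ℕ} (hpq : p ≤ q) (hp : f p < x)
    (hq : x < f q) : ∃ e, p ≤ e ∧ e < q ∧
      ((p < e ∧ x = f e) ∨ (f e < x ∧ x < f (e + 1))) := by
  induction q, hpq using Nat.le_induction with
  | base => omega
  | succ q hpq ih =>
    rcases lt_trichotomy x (f q) with h | h | h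
    · obtain ⟨e, he, heq, h⟩ := ih h
      exact ⟨e, he, by omega, h⟩
    · refine ⟨q, hpq, by omega, Or.inl ⟨lt_of_le_of_ne hpq ?_, h⟩⟩
      rintro rfl
      omega
    · exact ⟨q, hpq, by omega, Or.inr ⟨h, hq⟩⟩

theorem local_maxima_inherit_star (m k : ℕ) (v : ℕ → ℕ)
    (hv : ∀ i j, i < j → j < m → v i < v j)
    (idx : ℕ → ℕ) (hmono : ∀ a b, a < b → b < k → idx a < idx b)
    (hrange : ∀ j, j < k → idx j < m - 1)
    (hstar : ∀ j, j + 1 < k → ∀ x, idx j < x → x < idx (j + 1) →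
      dseq v x < max (dseq v (idx j)) (dseq v (idx (j + 1)))) :
    ∀ p q : ℕ, 0 < p → p + 1 < k → 0 < q → q + 1 < k → p < q →
      dseq v (idx (p - 1)) < dseq v (idx p) → dseq v (idx (p + 1)) < dseq v (idx p) →
      dseq v (idx (q - 1)) < dseq v (idx q) → dseq v (idx (q + 1)) < dseq v (idx q) →
      (∀ e, p < e → e < q →
        ¬ (0 < e ∧ e + 1 < k ∧ dseq v (idx (e - 1)) < dseq v (idx e) ∧
            dseq v (idx (e + 1)) < dseq v (idx e))) →
      (∀ x, idx p < x → x < idx q →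
        dseq v x < max (dseq v (idx p)) (dseq v (idx q))) ∧
      dseq v (idx p) ≠ dseq v (idx q) := by
  intro p q hp hpk hq hqk hpq _ _ _ _ hno
  have hstep : ∀ j, j < k → v (idx j) < v (idx j + 1) := fun j hj =>
    hv _ _ (by omega) (by have := hrange j hj; omega)
  have hadj : ∀ e, e + 1 < k → dseq v (idx e) ≠ dseq v (idx (e + 1)) := by
    intro e he heq
    refine dseq_ne_of_forall_between_lt (hmono e (e + 1) (by omega) he) (hstep _ (by omega))
      (hstep _ he) (fun z hz hz' => ?_) heq
    simpa [← heq] using hstar e he z hz hz'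
  have hinner := lt_max_of_no_local_max (d := fun e => dseq v (idx e)) (p := p) (q := q)
    (fun e _ he => hadj e (by omega))
    (fun e he he' h => hno e he he' ⟨by omega, by omega, h.1, h.2⟩)
  have hle : ∀ e, p ≤ e → e ≤ q →
      dseq v (idx e) ≤ max (dseq v (idx p)) (dseq v (idx q)) := by
    intro e hpe heq
    rcases hpe.eq_or_lt with rfl | hpe
    · exact le_max_left _ _
    rcases heq.eq_or_lt with rfl | heq
    · exact le_max_right _ _
    exact (hinner e hpe heq).le
  have hbetween : ∀ x, idx p < x → x < idx q →
      dseq v x < max (dseq v (idx p)) (dseq v (idx q)) := by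
    intro x hpx hxq
    obtain ⟨e, hpe, heq, ⟨hpe', rfl⟩ | ⟨hex, hxe⟩⟩ := exists_eq_or_between hpq.le hpx hxq
    · exact hinner e hpe' heq
    · exact (hstar e (by omega) x hex hxe).trans_le
        (max_le (hle e hpe heq.le) (hle (e + 1) (by omega) heq))
  refine ⟨hbetween, fun heq => ?_⟩
  refine dseq_ne_of_forall_between_lt (hmono p q hpq (by omega)) (hstep p (by omega))
    (hstep q (by omega)) (fun z hz hz' => ?_) heq
  simpa [← heq] using hbetween z hz hz'
end
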